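/- Let f : ℝ^n → ℝ be L-smooth convex for some L > 0, and let (x, z) be a solution of the NAG ODE with parameter r = 2 and initial point x₀. Define p(t) := (8/t²)(x(t) − z(t)) (equivalently p(t) = −(4/t)ẋ(t)) for t > 0. Assume p⋆ ∈ dom f* and p⋆ ≠ 0, and set D := D_f(x₀, p⋆). Then for all t > 0, ‖p(t)‖² − ‖p⋆‖² ≤ 944·D/(9t²) + 64·D²/(‖p⋆‖²·t⁴). -/

import Mathlib

open scoped InnerProductSpace
open Filter Topology

/-- Legendre–Fenchel conjugate of `f`, valued in `ℝ ∪ {∞}` (modeled in `EReal`). -/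
noncomputable def fconj {n : ℕ} (f : EuclideanSpace ℝ (Fin n) → ℝ)
    (p : EuclideanSpace ℝ (Fin n)) : EReal :=
  ⨆ x : EuclideanSpace ℝ (Fin n), ((⟪p, x⟫_ℝ - f x : ℝ) : EReal)

/-- Effective domain `dom f*` of the Legendre–Fenchel conjugate. -/
noncomputable def fconjDom {n : ℕ} (f : EuclideanSpace ℝ (Fin n) → ℝ) :
    Set (EuclideanSpace ℝ (Fin n)) := {p | fconj f p < ⊤}

/-- Dual divergence `D_f(x, p) = f x + f*(p) − ⟨p, x⟩` (meaningful for `p ∈ dom f*`). -/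
noncomputable def dualDiv {n : ℕ} (f : EuclideanSpace ℝ (Fin n) → ℝ)
    (x p : EuclideanSpace ℝ (Fin n)) : ℝ :=
  f x + (fconj f p).toReal - ⟪p, x⟫_ℝ

/-- `f` is `L`-smooth convex: convex, differentiable, with `L`-Lipschitz gradient. -/
def LSmoothConvex {n : ℕ} (L : ℝ) (f : EuclideanSpace ℝ (Fin n) → ℝ) : Prop :=
  ConvexOn ℝ Set.univ f ∧ Differentiable ℝ f ∧
    LipschitzWith (Real.toNNReal L) (fun x => gradient f x)

theorem ConvexOn.add_inner_gradient_le {E : Type*} [NormedAddCommGroup E] [InnerProductSpace ℝ E]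
    [CompleteSpace E] {f : E → ℝ} (hc : ConvexOn ℝ Set.univ f) (hd : Differentiable ℝ f)
    (x u : E) : f x + ⟪gradient f x, u - x⟫_ℝ ≤ f u := by
  have hconv : ConvexOn ℝ Set.univ (f ∘ AffineMap.lineMap (k := ℝ) x u) := by
    simpa using hc.comp_affineMap (AffineMap.lineMap (k := ℝ) x u)
  have hderiv : HasDerivAt (f ∘ AffineMap.lineMap (k := ℝ) x u) ⟪gradient f x, u - x⟫_ℝ 0 := by
    have h1 : HasFDerivAt f (InnerProductSpace.toDual ℝ E (gradient f x))
        (AffineMap.lineMap (k := ℝ) x u 0) := by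
      simpa using (hd x).hasGradientAt.hasFDerivAt
    simpa using h1.comp_hasDerivAt (0 : ℝ) AffineMap.hasDerivAt_lineMap
  have h := hconv.le_slope_of_hasDerivAt (Set.mem_univ 0) (Set.mem_univ 1) one_pos hderiv
  simp only [slope_def_field, Function.comp_apply, AffineMap.lineMap_apply_zero,
    AffineMap.lineMap_apply_one, sub_zero, div_one] at h
  linarith

theorem inner_sub_le_toReal_fconj {n : ℕ} {f : EuclideanSpace ℝ (Fin n) → ℝ}
    {p : EuclideanSpace ℝ (Fin n)} (hp : p ∈ fconjDom f) (x : EuclideanSpace ℝ (Fin n)) :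
    ⟪p, x⟫_ℝ - f x ≤ (fconj f p).toReal := by
  have h : ((⟪p, x⟫_ℝ - f x : ℝ) : EReal) ≤ fconj f p :=
    le_iSup (fun y => ((⟪p, y⟫_ℝ - f y : ℝ) : EReal)) x
  have hp' : fconj f p ≠ ⊤ := ne_of_lt hp
  exact EReal.toReal_le_toReal h (EReal.coe_ne_bot _) hp'

theorem mem_fconjDom_of_forall_le {n : ℕ} {f : EuclideanSpace ℝ (Fin n) → ℝ}
    {p : EuclideanSpace ℝ (Fin n)} (c : ℝ) (h : ∀ x, ⟪p, x⟫_ℝ - f x ≤ c) : p ∈ fconjDom f :=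
  lt_of_le_of_lt (iSup_le fun x => EReal.coe_le_coe_iff.2 (h x)) (EReal.coe_lt_top c)

theorem convex_fconjDom {n : ℕ} (f : EuclideanSpace ℝ (Fin n) → ℝ) : Convex ℝ (fconjDom f) := by
  intro p hp q hq a b ha hb hab
  refine mem_fconjDom_of_forall_le (a * (fconj f p).toReal + b * (fconj f q).toReal) fun x => ?_
  have h1 := mul_le_mul_of_nonneg_left (inner_sub_le_toReal_fconj hp x) ha
  have h2 := mul_le_mul_of_nonneg_left (inner_sub_le_toReal_fconj hq x) hb
  have h3 : f x = a * f x + b * f x := by rw [← add_mul, hab, one_mul]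
  rw [inner_add_left, real_inner_smul_left, real_inner_smul_left]
  linarith

theorem gradient_mem_fconjDom {n : ℕ} {f : EuclideanSpace ℝ (Fin n) → ℝ}
    (hc : ConvexOn ℝ Set.univ f) (hd : Differentiable ℝ f) (x : EuclideanSpace ℝ (Fin n)) :
    gradient f x ∈ fconjDom f := by
  refine mem_fconjDom_of_forall_le (⟪gradient f x, x⟫_ℝ - f x) fun u => ?_
  have h := hc.add_inner_gradient_le hd x u
  rw [inner_sub_right] at h
  linarith

theorem Convex.norm_sq_le_inner_of_forall_norm_le {E : Type*} [NormedAddCommGroup E]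
    [InnerProductSpace ℝ E] {s : Set E} (hs : Convex ℝ s) {p q : E} (hp : p ∈ s) (hq : q ∈ s)
    (hmin : ∀ y ∈ s, ‖p‖ ≤ ‖y‖) : ‖p‖ ^ 2 ≤ ⟪p, q⟫_ℝ := by
  have : Nonempty s := ⟨⟨p, hp⟩⟩
  have h : ‖0 - p‖ = ⨅ w : s, ‖0 - (w : E)‖ := by
    refine le_antisymm (le_ciInf fun w => by simpa using hmin w w.2) ?_
    exact ciInf_le (f := fun w : s => ‖0 - (w : E)‖)
      ⟨0, by rintro _ ⟨w, rfl⟩; exact norm_nonneg _⟩ ⟨p, hp⟩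
  have h2 := (norm_eq_iInf_iff_real_inner_le_zero hs hp).1 h q hq
  rw [zero_sub, inner_neg_left, inner_sub_right, real_inner_self_eq_norm_sq] at h2
  linarith

/-- for a solution `(x, z)` of the NAG ODE with `r = 2`, with
`p(t) := (8/t²)(x(t) − z(t))`, if `p⋆ ∈ dom f*` and `p⋆ ≠ 0` then, with
`D := D_f(x₀, p⋆)`, for all `t > 0`:
`‖p(t)‖² − ‖p⋆‖² ≤ 944 D/(9t²) + 64 D²/(‖p⋆‖² t⁴)`. -/
theorem stmt14 {n : ℕ} (hn : 1 ≤ n) (L : ℝ) (hL : 0 < L)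
    (f : EuclideanSpace ℝ (Fin n) → ℝ) (hf : LSmoothConvex L f)
    (x₀ : EuclideanSpace ℝ (Fin n))
    (x z x' z' : ℝ → EuclideanSpace ℝ (Fin n))
    (hx : ∀ t ∈ Set.Ici (0 : ℝ), HasDerivWithinAt x (x' t) (Set.Ici 0) t)
    (hx' : ContinuousOn x' (Set.Ici 0))
    (hz : ∀ t ∈ Set.Ici (0 : ℝ), HasDerivWithinAt z (z' t) (Set.Ici 0) t)
    (hz' : ContinuousOn z' (Set.Ici 0))
    (hx0 : x 0 = x₀) (hz0 : z 0 = x₀)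
    (hode1 : ∀ t > (0 : ℝ), x' t = ((2 : ℝ) / t) • (z t - x t))
    (hode2 : ∀ t > (0 : ℝ), z' t = -((t / 2) • gradient f (x t)))
    (pstar : EuclideanSpace ℝ (Fin n))
    (hps : pstar ∈ closure (fconjDom f))
    (hmin : ∀ q ∈ closure (fconjDom f), ‖pstar‖ ≤ ‖q‖)
    (hpd : pstar ∈ fconjDom f) (hpne : pstar ≠ 0) :
    ∀ t > (0 : ℝ),
      ‖(8 / t ^ 2) • (x t - z t)‖ ^ 2 - ‖pstar‖ ^ 2 ≤
        944 * dualDiv f x₀ pstar / (9 * t ^ 2) +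
          64 * dualDiv f x₀ pstar ^ 2 / (‖pstar‖ ^ 2 * t ^ 4) := by
  obtain ⟨hc, hd, -⟩ := hf
  have hxc : ContinuousOn x (Set.Ici 0) := fun t ht => (hx t ht).continuousWithinAt
  have hzc : ContinuousOn z (Set.Ici 0) := fun t ht => (hz t ht).continuousWithinAt
  have hxd : ∀ t > (0 : ℝ), HasDerivAt x ((2 / t) • (z t - x t)) t := fun t ht =>
    hode1 t ht ▸ (hx t ht.le).hasDerivAt (Ici_mem_nhds ht)
  have hzd : ∀ t > (0 : ℝ), HasDerivAt z (-((t / 2) • gradient f (x t))) t := fun t ht =>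
    hode2 t ht ▸ (hz t ht.le).hasDerivAt (Ici_mem_nhds ht)
  set D := dualDiv f x₀ pstar with hD
  -- the energy estimate, anchored at the initial point
  have energy : ∀ t > (0 : ℝ), t ^ 2 / 4 * (f (x t) - f x₀) + ‖z t - x₀‖ ^ 2 / 2 ≤ 0 := by
    have hanti : AntitoneOn (fun t => t ^ 2 / 4 * (f (x t) - f x₀) + ‖z t - x₀‖ ^ 2 / 2)
        (Set.Ici 0) := by
      have hder : ∀ t > (0 : ℝ), HasDerivAt
          (fun t => t ^ 2 / 4 * (f (x t) - f x₀) + ‖z t - x₀‖ ^ 2 / 2)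
          (t / 2 * (f (x t) + ⟪gradient f (x t), x₀ - x t⟫_ℝ - f x₀)) t := by
        intro t ht
        have hfx : HasDerivAt (fun s => f (x s))
            ⟪gradient f (x t), (2 / t) • (z t - x t)⟫_ℝ t := by
          exact (hd (x t)).hasGradientAt.hasFDerivAt.comp_hasDerivAt t (hxd t ht)
        have h1 := (((hasDerivAt_pow 2 t).div_const 4).mul (hfx.sub_const (f x₀))).add
          (((hzd t ht).sub_const x₀).norm_sq.div_const 2)
        refine h1.congr_deriv ?_
        simp only [inner_neg_right, real_inner_smul_right, inner_sub_right, inner_sub_left,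
          real_inner_comm (gradient f (x t))]
        field_simp
        push_cast
        ring
      refine antitoneOn_of_deriv_nonpos (convex_Ici 0) ?_ ?_ ?_
      · exact (by fun_prop : ContinuousOn (fun t : ℝ => t ^ 2 / 4) (Set.Ici 0)).mul
          ((hd.continuous.comp_continuousOn hxc).sub continuousOn_const) |>.add
          (((hzc.sub continuousOn_const).norm.pow 2).div_const 2)
      · intro t ht
        rw [interior_Ici] at ht
        exact (hder t ht).differentiableAt.differentiableWithinAt
      · intro t ht
        rw [interior_Ici] at ht
        rw [(hder t ht).deriv]
        have h1 := hc.add_inner_gradient_le hd (x t) x₀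
        exact mul_nonpos_of_nonneg_of_nonpos (half_pos ht).le (by linarith)
    intro t ht
    simpa [hx0, hz0] using hanti (Set.self_mem_Ici) ht.le ht.le
  have hvar : ∀ q ∈ fconjDom f, ‖pstar‖ ^ 2 ≤ ⟪pstar, q⟫_ℝ := fun q hq =>
    (convex_fconjDom f).norm_sq_le_inner_of_forall_norm_le hpd hq
      fun y hy => hmin y (subset_closure hy)
  have hinner : ∀ t > (0 : ℝ),
      0 ≤ t ^ 2 * ⟪pstar, x t - z t⟫_ℝ - t ^ 4 / 8 * ‖pstar‖ ^ 2 := by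
    have hmono : MonotoneOn
        (fun t => t ^ 2 * ⟪pstar, x t - z t⟫_ℝ - t ^ 4 / 8 * ‖pstar‖ ^ 2) (Set.Ici 0) := by
      have hder : ∀ t > (0 : ℝ), HasDerivAt
          (fun t => t ^ 2 * ⟪pstar, x t - z t⟫_ℝ - t ^ 4 / 8 * ‖pstar‖ ^ 2)
          (t ^ 3 / 2 * (⟪pstar, gradient f (x t)⟫_ℝ - ‖pstar‖ ^ 2)) t := by
        intro t ht
        have h1 := ((hasDerivAt_pow 2 t).mul ((hasDerivAt_const t pstar).inner ℝ
          ((hxd t ht).sub (hzd t ht)))).sub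
          (((hasDerivAt_pow 4 t).div_const 8).mul_const (‖pstar‖ ^ 2))
        refine h1.congr_deriv ?_
        simp only [inner_neg_right, real_inner_smul_right, inner_sub_right, inner_zero_left,
          Pi.sub_apply]
        field_simp
        push_cast
        ring
      refine monotoneOn_of_deriv_nonneg (convex_Ici 0) ?_ ?_ ?_
      · exact ((by fun_prop : ContinuousOn (fun t : ℝ => t ^ 2) (Set.Ici 0)).mul
          (continuousOn_const.inner (hxc.sub hzc))).sub (by fun_prop)
      · intro t ht
        rw [interior_Ici] at ht
        exact (hder t ht).differentiableAt.differentiableWithinAt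
      · intro t ht
        rw [interior_Ici] at ht
        rw [(hder t ht).deriv]
        have h1 := hvar _ (gradient_mem_fconjDom hc hd (x t))
        have h2 : (0 : ℝ) < t := ht
        exact mul_nonneg (by positivity) (by linarith)
    intro t ht
    simpa using hmono (Set.self_mem_Ici) ht.le ht.le
  have hD0 : 0 ≤ D := by
    have := inner_sub_le_toReal_fconj hpd x₀
    simp only [hD, dualDiv]
    linarith
  have hmain : ∀ t > (0 : ℝ), ‖(4 : ℝ) • (x₀ - z t) - t ^ 2 • pstar‖ ^ 2 +
      (8 * t ^ 2 * ⟪pstar, x t - z t⟫_ℝ - t ^ 4 * ‖pstar‖ ^ 2) ≤ 8 * D * t ^ 2 := by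
    intro t ht
    have h1 := energy t ht
    have h2 := inner_sub_le_toReal_fconj hpd (x t)
    have h3 : t ^ 2 / 4 * (⟪pstar, x t⟫_ℝ - ⟪pstar, x₀⟫_ℝ - D) ≤
        t ^ 2 / 4 * (f (x t) - f x₀) := by
      apply mul_le_mul_of_nonneg_left _ (by positivity)
      simp only [hD, dualDiv]
      linarith
    rw [norm_sub_sq_real, norm_smul, norm_smul, real_inner_smul_left, real_inner_smul_right,
      norm_sub_rev, real_inner_comm, inner_sub_right, inner_sub_right, mul_pow, mul_pow]
    simp only [Real.norm_eq_abs, sq_abs]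
    linarith
  have hq : ∀ t > (0 : ℝ), ‖(4 : ℝ) • (x₀ - z t) - t ^ 2 • pstar‖ ≤ √(8 * D) * t := by
    intro t ht
    have h1 := hmain t ht
    have h2 := hinner t ht
    refine abs_le_of_sq_le_sq' ?_ (by positivity) |>.2
    rw [mul_pow, Real.sq_sqrt (by positivity)]
    linarith
  have hR : ∀ t > (0 : ℝ),
      ‖(8 * t ^ 2) • (x t - x₀) + t ^ 4 • pstar‖ ≤ 4 / 3 * √(8 * D) * t ^ 3 := by
    intro t ht
    have hder : ∀ s ∈ Set.Ici (0 : ℝ), HasDerivWithinAt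
        (fun s => (8 * s ^ 2) • (x s - x₀) + s ^ 4 • pstar)
        ((8 * s ^ 2) • x' s + (16 * s) • (x s - x₀) + (4 * s ^ 3) • pstar) (Set.Ici 0) s := by
      intro s hs
      have h1 := ((((hasDerivAt_pow 2 s).const_mul 8).hasDerivWithinAt).smul
        ((hx s hs).sub_const x₀)).add
        ((hasDerivAt_pow 4 s).hasDerivWithinAt.smul_const pstar)
      refine h1.congr_deriv ?_
      push_cast
      module
    have hB : ∀ s : ℝ, HasDerivAt (fun s => 4 / 3 * √(8 * D) * s ^ 3) (4 * √(8 * D) * s ^ 2) s := by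
      intro s
      refine ((hasDerivAt_pow 3 s).const_mul _).congr_deriv ?_
      push_cast
      ring
    refine image_norm_le_of_norm_deriv_right_le_deriv_boundary (a := 0) (b := t)
      (fun s hs => (hder s hs.1).continuousWithinAt.mono Set.Icc_subset_Ici_self)
      (fun s hs => (hder s hs.1).mono (Set.Ici_subset_Ici.2 hs.1)) ?_ hB ?_
      (Set.right_mem_Icc.2 ht.le)
    · simp
    · intro s hs
      rcases hs.1.eq_or_lt with rfl | hs0
      · simp
      · have h1 : (8 * s ^ 2) • x' s + (16 * s) • (x s - x₀) + (4 * s ^ 3) • pstar =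
            -((4 * s) • ((4 : ℝ) • (x₀ - z s) - s ^ 2 • pstar)) := by
          rw [hode1 s hs0, smul_smul, show 8 * s ^ 2 * (2 / s) = 16 * s by field_simp; norm_num]
          module
        rw [h1, norm_neg, norm_smul, Real.norm_of_nonneg (by positivity)]
        calc 4 * s * ‖(4 : ℝ) • (x₀ - z s) - s ^ 2 • pstar‖
            ≤ 4 * s * (√(8 * D) * s) := by gcongr; exact hq s hs0
          _ = 4 * √(8 * D) * s ^ 2 := by ring
  intro t ht
  have hdist : ‖(8 / t ^ 2) • (x t - z t) - pstar‖ ≤ 10 / 3 * √(8 * D) / t := by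
    have h1 : (8 / t ^ 2) • (x t - z t) - pstar = (1 / t ^ 4) •
        ((2 * t ^ 2) • ((4 : ℝ) • (x₀ - z t) - t ^ 2 • pstar) +
          ((8 * t ^ 2) • (x t - x₀) + t ^ 4 • pstar)) := by
      match_scalars <;> field_simp <;> ring
    rw [h1, norm_smul, Real.norm_of_nonneg (by positivity)]
    calc _ ≤ 1 / t ^ 4 * (2 * t ^ 2 * (√(8 * D) * t) + 4 / 3 * √(8 * D) * t ^ 3) := by
          gcongr
          refine (norm_add_le _ _).trans (add_le_add ?_ (hR t ht))
          rw [norm_smul, Real.norm_of_nonneg (by positivity)]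
          gcongr
          exact hq t ht
      _ = 10 / 3 * √(8 * D) / t := by
          field_simp
          ring
  have hsq : ‖(8 / t ^ 2) • (x t - z t) - pstar‖ ^ 2 ≤ 800 * D / (9 * t ^ 2) := by
    calc _ ≤ (10 / 3 * √(8 * D) / t) ^ 2 := by gcongr
      _ = 800 * D / (9 * t ^ 2) := by
        rw [div_pow, mul_pow, Real.sq_sqrt (by positivity)]
        ring
  have hlin : ⟪pstar, (8 / t ^ 2) • (x t - z t)⟫_ℝ - ‖pstar‖ ^ 2 ≤ 8 * D / t ^ 2 := by
    have h1 := hmain t ht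
    have h2 := sq_nonneg ‖(4 : ℝ) • (x₀ - z t) - t ^ 2 • pstar‖
    rw [real_inner_smul_right, le_div_iff₀ (by positivity)]
    have h3 : (8 / t ^ 2 * ⟪pstar, x t - z t⟫_ℝ - ‖pstar‖ ^ 2) * t ^ 2 =
        (8 * t ^ 2 * ⟪pstar, x t - z t⟫_ℝ - t ^ 4 * ‖pstar‖ ^ 2) / t ^ 2 := by
      field_simp
    rw [h3, div_le_iff₀ (by positivity)]
    linarith
  have hexp : ‖(8 / t ^ 2) • (x t - z t)‖ ^ 2 - ‖pstar‖ ^ 2 =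
      ‖(8 / t ^ 2) • (x t - z t) - pstar‖ ^ 2 +
        2 * (⟪pstar, (8 / t ^ 2) • (x t - z t)⟫_ℝ - ‖pstar‖ ^ 2) := by
    rw [norm_sub_sq_real, real_inner_comm]
    ring
  have hsum : 944 * D / (9 * t ^ 2) = 800 * D / (9 * t ^ 2) + 2 * (8 * D / t ^ 2) := by
    field_simp
    ring
  have hnonneg : 0 ≤ 64 * D ^ 2 / (‖pstar‖ ^ 2 * t ^ 4) := by positivity
  rw [hexp, hsum]
  linarith
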